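/- arXiv:math/0405309 — 2 statements merged into one kernel-verified Lean document; each statement's English description precedes it below -/
import Mathlib

section
/- For all 0 < a < 1, b < 1 and all n, x ∈ ℕ, the limit lim_{q→0⁺} p_n^{a,b;q}(x) exists and equals p_n^{a,b;0}(x), where p_0^{a,b;0}(x) = 1 for all x; p_1^{a,b;0}(0) = −a(1−b)/(1−a) and p_1^{a,b;0}(x) = 1 for x ≥ 1; and for n ≥ 2: p_n^{a,b;0}(x) = 0 if 0 ≤ x < n−1, p_n^{a,b;0}(n−1) = −a/(1−a), and p_n^{a,b;0}(x) = 1 if x > n−1. -/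
open Finset Filter Topology

/-- The q-Pochhammer symbol `(c;q)_k = ∏_{j=0}^{k-1} (1 - c q^j)`. -/
noncomputable def qPoch (q c : ℝ) (k : ℕ) : ℝ := ∏ j ∈ Finset.range k, (1 - c * q ^ j)

/-- The little q-Jacobi function
`p_n^{a,b;q}(x) = ∑_{k=0}^{n} [(q^{−n};q)_k (a b q^{n−1};q)_k / ((a;q)_k (q;q)_k)] q^{k(x+1)}`. -/
noncomputable def littleqJacobi (a b q : ℝ) (n x : ℕ) : ℝ :=
  ∑ k ∈ Finset.range (n + 1),
    qPoch q (q ^ (-(n : ℤ))) k * qPoch q (a * b * q ^ ((n : ℤ) - 1)) k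
      / (qPoch q a k * qPoch q q k) * q ^ (k * (x + 1))

/-- The little 0-Jacobi function `p_n^{a,b;0}(x)`. -/
noncomputable def littleZeroJacobi (a b : ℝ) (n x : ℕ) : ℝ :=
  if n = 0 then 1
  else if x < n - 1 then 0
  else if x = n - 1 then (if n = 1 then -(a * (1 - b)) / (1 - a) else -a / (1 - a))
  else 1

lemma qPoch_succ (q c : ℝ) (k : ℕ) : qPoch q c (k + 1) = qPoch q c k * (1 - c * q ^ k) := by
  simp [qPoch, Finset.prod_range_succ]

lemma qPoch_ne_zero (q c : ℝ) (k : ℕ) (hq0 : 0 < q) (hq1 : q < 1) (hc : c < 1) :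
    qPoch q c k ≠ 0 := by
  refine Finset.prod_ne_zero_iff.mpr fun j _ => ?_
  have h1 : q ^ j ≤ 1 := pow_le_one₀ hq0.le hq1.le
  have h0 : 0 < q ^ j := pow_pos hq0 j
  have : c * q ^ j < 1 := by nlinarith
  linarith

/-- The coefficient of the little q-Jacobi function. -/
noncomputable def tc (a b q : ℝ) (m : ℕ) (k : ℕ) : ℝ :=
  qPoch q (q ^ (-((m + 1 : ℕ) : ℤ))) k * qPoch q (a * b * q ^ m) k / (qPoch q a k * qPoch q q k)

lemma tc_succ (a b q : ℝ) (m k : ℕ) (hq0 : 0 < q) (hq1 : q < 1) (ha1 : a < 1) :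
    tc a b q m (k + 1) * ((1 - a * q ^ k) * (1 - q * q ^ k)) =
      tc a b q m k * ((1 - q ^ (-((m + 1 : ℕ) : ℤ)) * q ^ k) * (1 - a * b * q ^ m * q ^ k)) := by
  have h1 := qPoch_ne_zero q a (k + 1) hq0 hq1 ha1
  have h2 := qPoch_ne_zero q q (k + 1) hq0 hq1 hq1
  unfold tc
  rw [qPoch_succ] at h1 h2
  simp only [qPoch_succ]
  have h3 := left_ne_zero_of_mul h1
  have h4 := right_ne_zero_of_mul h1
  have h5 := left_ne_zero_of_mul h2
  have h6 := right_ne_zero_of_mul h2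
  generalize q ^ (-((m + 1 : ℕ) : ℤ)) = Q
  generalize qPoch q Q k = A
  generalize qPoch q (a * b * q ^ m) k = B
  generalize qPoch q a k = C at *
  generalize qPoch q q k = D at *
  generalize 1 - a * q ^ k = E at *
  generalize 1 - q * q ^ k = F at *
  field_simp

lemma jac_eq (a b q : ℝ) (m x : ℕ) :
    littleqJacobi a b q (m + 1) x =
      ∑ k ∈ Finset.range (m + 2), tc a b q m k * (q ^ (x + 1)) ^ k := by
  unfold littleqJacobi tc
  refine Finset.sum_congr rfl fun k _ => ?_
  have : q ^ (((m + 1 : ℕ) : ℤ) - 1) = q ^ m := by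
    rw [← zpow_natCast]; congr 1; push_cast; ring
  rw [this, ← pow_mul, mul_comm k]

lemma partial_sum (a b q ξ : ℝ) (m N : ℕ) (hq0 : 0 < q) (hq1 : q < 1) (ha1 : a < 1) :
    ∑ k ∈ Finset.range N, tc a b q m k * ξ ^ k * (a * (1 - b * ξ) * (q ^ k * (q ^ k - 1))
      + q * (1 - ξ) * (1 - q ^ k)
      + q * (q ^ (-((m + 1 : ℕ) : ℤ)) - 1) * (1 - a * b * q ^ m) * ξ * q ^ k)
    = - (tc a b q m N * (1 - q ^ N) * (q - a * q ^ N) * ξ ^ N) := by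
  induction N with
  | zero => simp
  | succ N ih =>
    rw [Finset.sum_range_succ, ih]
    have h := tc_succ a b q m N hq0 hq1 ha1
    have hQ : q ^ (-((m + 1 : ℕ) : ℤ)) * q ^ m * q = 1 := by
      rw [zpow_neg, zpow_natCast, mul_assoc, ← pow_succ]
      exact inv_mul_cancel₀ (pow_pos hq0 _).ne'
    generalize q ^ (-((m + 1 : ℕ) : ℤ)) = Q at *
    rw [pow_succ q N, pow_succ ξ N]
    generalize tc a b q m (N + 1) = T at *
    generalize tc a b q m N = t at *
    generalize q ^ N = K at *
    generalize q ^ m = P at *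
    generalize ξ ^ N = X at *
    linear_combination (q * X * ξ) * h + (t * X * ξ * a * b * K ^ 2 - t * X * ξ * a * b * K) * hQ

lemma tc_top (a b q : ℝ) (m : ℕ) (hq0 : 0 < q) : tc a b q m (m + 2) = 0 := by
  unfold tc
  rw [show m + 2 = (m + 1) + 1 from rfl, qPoch_succ]
  have : q ^ (-((m + 1 : ℕ) : ℤ)) * q ^ (m + 1) = 1 := by
    rw [zpow_neg, zpow_natCast]
    exact inv_mul_cancel₀ (pow_pos hq0 _).ne'
  rw [this]; simp

lemma diff_eq (a b q ξ : ℝ) (m : ℕ) (hq0 : 0 < q) (hq1 : q < 1) (ha1 : a < 1)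
    (Y : ℝ → ℝ) (hY : Y = fun z => ∑ k ∈ Finset.range (m + 2), tc a b q m k * z ^ k) :
    a * (1 - b * ξ) * (Y (q * q * ξ) - Y (q * ξ)) + q * (1 - ξ) * (Y ξ - Y (q * ξ))
      + q * (q ^ (-((m + 1 : ℕ) : ℤ)) - 1) * (1 - a * b * q ^ m) * ξ * Y (q * ξ) = 0 := by
  have h := partial_sum a b q ξ m (m + 2) hq0 hq1 ha1
  rw [tc_top a b q m hq0] at h
  have h0 : (0 : ℝ) = -(0 * (1 - q ^ (m + 2)) * (q - a * q ^ (m + 2)) * ξ ^ (m + 2)) := by ring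
  rw [h0, ← h, hY]
  simp only [← Finset.sum_sub_distrib, Finset.mul_sum, ← Finset.sum_add_distrib]
  refine Finset.sum_congr rfl fun k _ => ?_
  simp only [mul_pow]
  ring

/-- Multiplied q-difference equation, `x + d = m`. -/
lemma jac_rec (a b q : ℝ) (x d : ℕ) (hq0 : 0 < q) (hq1 : q < 1) (ha1 : a < 1) :
    littleqJacobi a b q (x + d + 1) x *
      (q ^ d * (a * (1 - b * q ^ x) + q * (1 - q ^ x))
        - (1 - q ^ (x + d + 1)) * (1 - a * b * q ^ (x + d)))
    = q ^ d * (a * (1 - b * q ^ x)) * littleqJacobi a b q (x + d + 1) (x + 1)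
      + q ^ d * (q * (1 - q ^ x)) * littleqJacobi a b q (x + d + 1) (x - 1) := by
  have h := diff_eq a b q (q ^ x) (x + d) hq0 hq1 ha1 _ rfl
  have hQ : q ^ (-((x + d + 1 : ℕ) : ℤ)) * (q ^ x * q ^ d * q) = 1 := by
    rw [zpow_neg, zpow_natCast, ← pow_add, ← pow_succ]
    exact inv_mul_cancel₀ (pow_pos hq0 _).ne'
  have e3 : (1 - q ^ x) * littleqJacobi a b q (x + d + 1) (x - 1) =
      (1 - q ^ x) * ∑ k ∈ Finset.range (x + d + 2), tc a b q (x + d) k * (q ^ x) ^ k := by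
    rcases x with _ | x
    · simp
    · rw [jac_eq]; simp
  rw [show q * q * q ^ x = q ^ (x + 1 + 1) by ring, show q * q ^ x = q ^ (x + 1) by ring,
    ← jac_eq, ← jac_eq] at h
  generalize q ^ (-((x + d + 1 : ℕ) : ℤ)) = Q at *
  generalize littleqJacobi a b q (x + d + 1) x = y at *
  generalize littleqJacobi a b q (x + d + 1) (x + 1) = y1 at *
  generalize littleqJacobi a b q (x + d + 1) (x - 1) = y2 at *
  generalize ∑ k ∈ Finset.range (x + d + 2), tc a b q (x + d) k * (q ^ x) ^ k = S at *
  rw [pow_succ, pow_add]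
  rw [pow_add] at h
  generalize q ^ x = X at *
  generalize q ^ d = D at *
  linear_combination (-D) * h - q * D * e3 + y * (1 - a * b * (X * D)) * hQ

lemma tendsto_pow_nhds (k : ℕ) (hk : k ≠ 0) :
    Tendsto (fun q : ℝ => q ^ k) (𝓝[Set.Ioo (0 : ℝ) 1] 0) (𝓝 0) := by
  have : Tendsto (fun q : ℝ => q ^ k) (𝓝 0) (𝓝 (0 ^ k)) := (continuous_pow k).tendsto 0
  rw [zero_pow hk] at this
  exact this.mono_left nhdsWithin_le_nhds

lemma ratio (a b : ℝ) (ha1 : a < 1) (m x : ℕ) (hx : x < m) :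
    ∃ c : ℝ → ℝ, Tendsto c (𝓝[Set.Ioo (0 : ℝ) 1] 0) (𝓝 0) ∧
      ∀ᶠ q in 𝓝[Set.Ioo (0 : ℝ) 1] 0,
        littleqJacobi a b q (m + 1) x = c q * littleqJacobi a b q (m + 1) (x + 1) := by
  have key : ∀ (x : ℕ), x < m → ∀ c : ℝ → ℝ, Tendsto c (𝓝[Set.Ioo (0 : ℝ) 1] 0) (𝓝 0) →
      (∀ᶠ q in 𝓝[Set.Ioo (0 : ℝ) 1] 0, (1 - q ^ x) * littleqJacobi a b q (m + 1) (x - 1)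
        = (1 - q ^ x) * (c q * littleqJacobi a b q (m + 1) x)) →
      ∃ c : ℝ → ℝ, Tendsto c (𝓝[Set.Ioo (0 : ℝ) 1] 0) (𝓝 0) ∧
      ∀ᶠ q in 𝓝[Set.Ioo (0 : ℝ) 1] 0,
        littleqJacobi a b q (m + 1) x = c q * littleqJacobi a b q (m + 1) (x + 1) := by
    intro x hx c hc hce
    obtain ⟨d, rfl⟩ := Nat.exists_eq_add_of_le hx.le
    have hd : d ≠ 0 := by omega
    let den : ℝ → ℝ := fun q => q ^ d * (a * (1 - b * q ^ x) + q * (1 - q ^ x)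
        - q * (1 - q ^ x) * c q) - (1 - q ^ (x + d + 1)) * (1 - a * b * q ^ (x + d))
    have tid : Tendsto (fun q : ℝ => q) (𝓝[Set.Ioo (0 : ℝ) 1] 0) (𝓝 0) := by
      simpa using tendsto_pow_nhds 1 one_ne_zero
    have tx : Tendsto (fun q : ℝ => q ^ x) (𝓝[Set.Ioo (0 : ℝ) 1] 0) (𝓝 (0 ^ x)) := tid.pow x
    have td := tendsto_pow_nhds d hd
    have t1 := tendsto_pow_nhds (x + d + 1) (by omega)
    have t2 := tendsto_pow_nhds (x + d) (by omega)
    have tA : Tendsto (fun q : ℝ => a * (1 - b * q ^ x)) (𝓝[Set.Ioo (0 : ℝ) 1] 0)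
        (𝓝 (a * (1 - b * 0 ^ x))) := ((tx.const_mul b).const_sub 1).const_mul a
    have tB : Tendsto (fun q : ℝ => q * (1 - q ^ x)) (𝓝[Set.Ioo (0 : ℝ) 1] 0)
        (𝓝 (0 * (1 - 0 ^ x))) := tid.mul (tx.const_sub 1)
    have tden : Tendsto den (𝓝[Set.Ioo (0 : ℝ) 1] 0) (𝓝 (-1)) := by
      have := (td.mul ((tA.add tB).sub (tB.mul hc))).sub
        ((t1.const_sub 1).mul ((t2.const_mul (a * b)).const_sub 1))
      convert this using 2
      ring
    refine ⟨fun q => q ^ d * (a * (1 - b * q ^ x)) / den q, ?_, ?_⟩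
    · have := (td.mul tA).div tden (by norm_num)
      rw [zero_mul, zero_div] at this
      exact this
    · filter_upwards [hce, self_mem_nhdsWithin, tden.eventually_ne (by norm_num : (-1 : ℝ) ≠ 0)]
        with q h1 hq h2
      have h := jac_rec a b q x d hq.1 hq.2 ha1
      rw [div_mul_eq_mul_div, eq_div_iff h2]
      simp only [den]
      linear_combination h + q ^ d * q * h1
  induction x with
  | zero => exact key 0 hx (fun _ => 0) tendsto_const_nhds (by simp)
  | succ x ih =>
    obtain ⟨c, hc, hce⟩ := ih (by omega)
    refine key (x + 1) hx c hc ?_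
    filter_upwards [hce] with q hq
    simp [hq]

lemma upper (a b : ℝ) (ha1 : a < 1) (m d : ℕ) :
    Tendsto (fun q : ℝ => littleqJacobi a b q (m + 1) (m + d))
      (𝓝[Set.Ioo (0 : ℝ) 1] 0) (𝓝 (1 - 0 ^ d * (1 - a * b * 0 ^ m) / (1 - a))) := by
  let F : ℕ → ℝ → ℝ := fun k q => q ^ (k * d) * (∏ j ∈ Finset.range k, (q ^ (m + 1) - q ^ j)) *
    (∏ j ∈ Finset.range k, (1 - a * b * q ^ m * q ^ j)) /
    ((∏ j ∈ Finset.range k, (1 - a * q ^ j)) * (∏ j ∈ Finset.range k, (1 - q * q ^ j)))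
  have hden : ∀ k, (∏ j ∈ Finset.range k, (1 - a * (0 : ℝ) ^ j)) *
      (∏ j ∈ Finset.range k, (1 - 0 * (0 : ℝ) ^ j)) ≠ 0 := by
    intro k
    simp only [zero_mul, sub_zero, Finset.prod_const_one, mul_one]
    refine Finset.prod_ne_zero_iff.mpr fun j _ => ?_
    rcases j with _ | j
    · simp; linarith
    · simp
  have hcont : ∀ k, ContinuousAt (F k) 0 := by
    intro k
    refine ContinuousAt.div ?_ ?_ (hden k)
    · exact Continuous.continuousAt (by fun_prop)
    · exact Continuous.continuousAt (by fun_prop)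
  have hS : Tendsto (fun q => ∑ k ∈ Finset.range (m + 2), F k q) (𝓝[Set.Ioo (0 : ℝ) 1] 0)
      (𝓝 (∑ k ∈ Finset.range (m + 2), F k 0)) :=
    tendsto_finsetSum _ fun k _ => (hcont k).tendsto.mono_left nhdsWithin_le_nhds
  have hval : ∑ k ∈ Finset.range (m + 2), F k 0 = 1 - 0 ^ d * (1 - a * b * 0 ^ m) / (1 - a) := by
    rw [Finset.sum_range_succ', Finset.sum_range_succ']
    have hz : ∑ k ∈ Finset.range m, F (k + 1 + 1) 0 = 0 := by
      refine Finset.sum_eq_zero fun k _ => ?_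
      have : ∏ j ∈ Finset.range (k + 1 + 1), ((0 : ℝ) ^ (m + 1) - 0 ^ j) = 0 :=
        Finset.prod_eq_zero (i := 1) (by simp) (by simp)
      simp only [F, this]; simp
    rw [hz]
    simp [F]
    ring
  rw [← hval]
  refine hS.congr' ?_
  filter_upwards [self_mem_nhdsWithin] with q hq
  rw [jac_eq]
  refine Finset.sum_congr rfl fun k _ => ?_
  have hp : qPoch q (q ^ (-((m + 1 : ℕ) : ℤ))) k * (q ^ (m + 1)) ^ k =
      ∏ j ∈ Finset.range k, (q ^ (m + 1) - q ^ j) := by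
    unfold qPoch
    rw [show (q ^ (m + 1)) ^ k = ∏ _j ∈ Finset.range k, q ^ (m + 1) by simp,
      ← Finset.prod_mul_distrib]
    refine Finset.prod_congr rfl fun j _ => ?_
    have : q ^ (-((m + 1 : ℕ) : ℤ)) * q ^ (m + 1) = 1 := by
      rw [zpow_neg, zpow_natCast]
      exact inv_mul_cancel₀ (pow_pos hq.1 _).ne'
    linear_combination (-q ^ j) * this
  simp only [F]
  rw [← hp]
  simp only [tc, qPoch]
  rw [show (q ^ (m + d + 1)) ^ k = (q ^ (m + 1)) ^ k * q ^ (k * d) by ring]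
  ring

theorem littleqJacobi_tendsto_zero (a b : ℝ) (ha0 : 0 < a) (ha1 : a < 1) (hb : b < 1)
    (n x : ℕ) :
    Tendsto (fun q : ℝ => littleqJacobi a b q n x)
      (𝓝[Set.Ioo (0 : ℝ) 1] 0) (𝓝 (littleZeroJacobi a b n x)) := by
  rcases n with _ | m
  · simp [littleqJacobi, littleZeroJacobi, qPoch]
  have h1a : 1 - a ≠ 0 := by linarith
  rcases lt_or_ge x m with hx | hx
  · have hv : littleZeroJacobi a b (m + 1) x = 0 := by simp [littleZeroJacobi, hx]
    rw [hv]
    have step : ∀ y, y < m → ∀ l : ℝ, Tendsto (fun q : ℝ => littleqJacobi a b q (m + 1) (y + 1))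
        (𝓝[Set.Ioo (0 : ℝ) 1] 0) (𝓝 l) → Tendsto (fun q : ℝ => littleqJacobi a b q (m + 1) y)
        (𝓝[Set.Ioo (0 : ℝ) 1] 0) (𝓝 0) := by
      intro y hy l hl
      obtain ⟨c, hc, hce⟩ := ratio a b ha1 m y hy
      have := hc.mul hl
      rw [zero_mul] at this
      exact this.congr' (hce.mono fun q h => h.symm)
    have all : ∀ e y, y + e + 1 = m → Tendsto (fun q : ℝ => littleqJacobi a b q (m + 1) y)
        (𝓝[Set.Ioo (0 : ℝ) 1] 0) (𝓝 0) := by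
      intro e
      induction e with
      | zero =>
        intro y hy
        have := upper a b ha1 m 0
        refine step y (by omega) (1 - 0 ^ 0 * (1 - a * b * 0 ^ m) / (1 - a)) ?_
        · rw [show y + 1 = m + 0 by omega]; exact this
      | succ e ih =>
        intro y hy
        exact step y (by omega) 0 (ih (y + 1) (by omega))
    exact all (m - x - 1) x (by omega)
  · obtain ⟨d, rfl⟩ := Nat.exists_eq_add_of_le hx
    have h := upper a b ha1 m d
    convert h using 2
    rcases d with _ | d
    · rcases m with _ | m
      · simp [littleZeroJacobi]; field_simp; ring
      · simp [littleZeroJacobi]; field_simp; ring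
    · simp [littleZeroJacobi]
end

section
/- Let 0 < a < 1 and b < 1, and define C_{x,y,z}^{a,b,0} = [(1−a)/(1−ab)] · ∑_{n=0}^{min(x,y,z)+1} p_n^{a,b;0}(x) p_n^{a,b;0}(y) p_n^{a,b;0}(z) ω_n^{a,b;0} for x, y, z ∈ ℕ. Then C_{x,y,z}^{a,b,0} is symmetric in x, y, z; the product formula p_n^{a,b;0}(x) p_n^{a,b;0}(y) = [(1−ab)/(1−a)] · ∑_{z=0}^{∞} C_{x,y,z}^{a,b,0} w_z^{a,b;0} p_n^{a,b;0}(z) holds for all n ∈ ℕ; and for x ≤ y ≤ z one has explicitly: C_{x,y,z}^{a,b,0} = 0 if 0 ≤ x < y ≤ z; = 1 if 0 = x = y < z; = (1−b)^{−1} a^{−x} if 0 < x = y < z; = (1−2a+ab)/(1−a) if 0 = x = y = z; and = (1−2a) a^{−x} / ((1−a)(1−b)) if 0 < x = y = z. -/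
open Finset

/-- The q = 0 weight `w_x^{a,b;0}`. -/
noncomputable def littleZeroJacobiWeight (a b : ℝ) (x : ℕ) : ℝ :=
  if x = 0 then (1 - a) / (1 - a * b) else (1 - a) * (1 - b) * a ^ x / (1 - a * b)

/-- The q = 0 dual weight `ω_n^{a,b;0}`. -/
noncomputable def littleZeroJacobiDualWeight (a b : ℝ) (n : ℕ) : ℝ :=
  if n = 0 then 1
  else if n = 1 then (1 - a) / (a * (1 - b))
  else (1 - a) * (1 - a * b) / (a ^ n * (1 - b))

/-- The symmetric kernel
`C_{x,y,z}^{a,b,0} = [(1−a)/(1−ab)] ·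
  ∑_{n=0}^{min(x,y,z)+1} p_n^{a,b;0}(x) p_n^{a,b;0}(y) p_n^{a,b;0}(z) ω_n^{a,b;0}`. -/
noncomputable def symCoeff (a b : ℝ) (x y z : ℕ) : ℝ :=
  (1 - a) / (1 - a * b) *
    ∑ n ∈ Finset.range (min x (min y z) + 2),
      littleZeroJacobi a b n x * littleZeroJacobi a b n y * littleZeroJacobi a b n z *
        littleZeroJacobiDualWeight a b n

lemma lzj_transfer {f g : ℕ → ℝ} {s t : ℝ} (hg : HasSum g t) (h : ∀ i, f i = g i)
    (hs : s = t) : HasSum f s := by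
  rw [hs, funext h]
  exact hg

lemma lzj_swap12 (a b : ℝ) (x y z : ℕ) : symCoeff a b x y z = symCoeff a b y x z := by
  unfold symCoeff
  rw [show min x (min y z) = min y (min x z) by omega]
  congr 1
  refine Finset.sum_congr rfl fun n _ => ?_
  ring

lemma lzj_swap23 (a b : ℝ) (x y z : ℕ) : symCoeff a b x y z = symCoeff a b x z y := by
  unfold symCoeff
  rw [show min x (min y z) = min x (min z y) by omega]
  congr 1
  refine Finset.sum_congr rfl fun n _ => ?_
  ring

lemma lzj_one (a b : ℝ) (n x : ℕ) (h : n ≤ x) : littleZeroJacobi a b n x = 1 := by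
  unfold littleZeroJacobi
  by_cases h0 : n = 0
  · simp [h0]
  · rw [if_neg h0, if_neg (by omega), if_neg (by omega)]

lemma lzj_zero (a b : ℝ) (n x : ℕ) (h : x + 1 < n) : littleZeroJacobi a b n x = 0 := by
  unfold littleZeroJacobi
  rw [if_neg (by omega), if_pos (by omega)]

lemma lzj_diag (a b : ℝ) (x : ℕ) : littleZeroJacobi a b (x + 1) x =
    if x = 0 then -(a * (1 - b)) / (1 - a) else -a / (1 - a) := by
  unfold littleZeroJacobi
  simp

lemma lzj_dualsum (a b : ℝ) (ha0 : 0 < a) (hb : b < 1) (k : ℕ) :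
    ∑ n ∈ Finset.range (k + 2), littleZeroJacobiDualWeight a b n =
      (1 - a * b) / (a ^ (k + 1) * (1 - b)) := by
  have hb' : (1 - b) ≠ 0 := by linarith
  have ha' := ha0.ne'
  induction k with
  | zero =>
    simp [Finset.sum_range_succ, littleZeroJacobiDualWeight]
    field_simp
    ring
  | succ k ih =>
    rw [Finset.sum_range_succ, ih]
    simp only [littleZeroJacobiDualWeight]
    rw [if_neg (by omega), if_neg (by omega)]
    field_simp
    ring

lemma lzj_coeff (a b : ℝ) (x y z : ℕ) (hxy : x ≤ y) (hyz : y ≤ z) :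
    symCoeff a b x y z = (1 - a) / (1 - a * b) *
      (∑ n ∈ Finset.range (x + 1), littleZeroJacobiDualWeight a b n +
      littleZeroJacobi a b (x + 1) x * littleZeroJacobi a b (x + 1) y *
        littleZeroJacobi a b (x + 1) z * littleZeroJacobiDualWeight a b (x + 1)) := by
  unfold symCoeff
  rw [show min x (min y z) + 2 = (x + 1) + 1 by omega, Finset.sum_range_succ]
  congr 2
  refine Finset.sum_congr rfl fun n hn => ?_
  rw [Finset.mem_range] at hn
  rw [lzj_one a b n x (by omega), lzj_one a b n y (by omega), lzj_one a b n z (by omega)]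
  ring

lemma lzj_ab (a b : ℝ) (ha0 : 0 < a) (ha1 : a < 1) (hb : b < 1) : 1 - a * b ≠ 0 := by
  nlinarith

lemma lzj_explicit (a b : ℝ) (ha0 : 0 < a) (ha1 : a < 1)
    (hb : b < 1) (x y z : ℕ) (hxy : x ≤ y) (hyz : y ≤ z) :
      symCoeff a b x y z =
        if x < y then 0
        else if x = 0 then (if y < z then 1 else (1 - 2 * a + a * b) / (1 - a))
        else if y < z then (1 - b)⁻¹ * a ^ (-(x : ℤ))
        else (1 - 2 * a) * a ^ (-(x : ℤ)) / ((1 - a) * (1 - b)) := by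
  rw [lzj_coeff a b x y z hxy hyz]
  have hab := lzj_ab a b ha0 ha1 hb
  have hb' : (1 - b) ≠ 0 := by linarith
  have h1a : (1 - a) ≠ 0 := by linarith
  have ha' := ha0.ne'
  rw [zpow_neg, zpow_natCast]
  rcases Nat.eq_zero_or_pos x with rfl | hx
  · have hs : ∑ n ∈ Finset.range (0 + 1), littleZeroJacobiDualWeight a b n = 1 := by
      simp [littleZeroJacobiDualWeight]
    have hw : littleZeroJacobiDualWeight a b (0 + 1) = (1 - a) / (a * (1 - b)) := by
      simp [littleZeroJacobiDualWeight]
    rw [hs, hw]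
    by_cases h1 : 0 < y
    · rw [if_pos h1, lzj_diag, if_pos rfl, lzj_one a b _ y (by omega), lzj_one a b _ z (by omega)]
      field_simp
      ring
    · obtain rfl : y = 0 := by omega
      rw [if_neg h1, if_pos rfl, lzj_diag, if_pos rfl]
      by_cases h2 : 0 < z
      · rw [if_pos h2, lzj_one a b _ z (by omega)]
        field_simp
        ring
      · obtain rfl : z = 0 := by omega
        rw [if_neg h2, lzj_diag, if_pos rfl]
        field_simp
        ring
  · obtain ⟨k, rfl⟩ : ∃ k, x = k + 1 := ⟨x - 1, by omega⟩
    have hw : littleZeroJacobiDualWeight a b (k + 1 + 1) =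
        (1 - a) * (1 - a * b) / (a ^ (k + 1 + 1) * (1 - b)) := by
      simp [littleZeroJacobiDualWeight]
    rw [lzj_dualsum a b ha0 hb, hw]
    by_cases h1 : k + 1 < y
    · rw [if_pos h1, lzj_diag, if_neg (by omega), lzj_one a b _ y (by omega),
        lzj_one a b _ z (by omega)]
      field_simp
      ring
    · obtain rfl : y = k + 1 := by omega
      rw [if_neg h1, if_neg (by omega), lzj_diag, if_neg (by omega)]
      by_cases h2 : k + 1 < z
      · rw [if_pos h2, lzj_one a b _ z (by omega)]
        field_simp
        ring
      · obtain rfl : z = k + 1 := by omega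
        rw [if_neg h2, lzj_diag, if_neg (by omega)]
        field_simp
        ring

lemma lzj_geom (a : ℝ) (ha0 : 0 < a) (ha1 : a < 1) (m : ℕ) :
    HasSum (fun z : ℕ => if m ≤ z then a ^ z else 0) (a ^ m / (1 - a)) := by
  rw [← hasSum_nat_add_iff' m]
  have h := (hasSum_geometric_of_lt_one ha0.le ha1).mul_left (a ^ m)
  have h0 : ∑ i ∈ Finset.range m, (if m ≤ i then a ^ i else 0) = 0 := by
    refine Finset.sum_eq_zero fun i hi => ?_
    rw [Finset.mem_range] at hi
    rw [if_neg (by omega)]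
  rw [h0, sub_zero, div_eq_mul_inv]
  refine lzj_transfer h (fun i => ?_) rfl
  rw [if_pos (by omega), pow_add, mul_comm]

lemma lzj_tail (a b : ℝ) (ha0 : 0 < a) (ha1 : a < 1) (n x : ℕ) :
    HasSum (fun z : ℕ => if x < z then a ^ z * littleZeroJacobi a b n z else 0)
      (if n ≤ x + 1 then a ^ (x + 1) / (1 - a) else 0) := by
  have h1a : (1 - a) ≠ 0 := by linarith
  by_cases h : n ≤ x + 1
  · rw [if_pos h]
    convert lzj_geom a ha0 ha1 (x + 1) using 1
    funext z
    by_cases hz : x < z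
    · rw [if_pos hz, if_pos (by omega), lzj_one a b n z (by omega), mul_one]
    · rw [if_neg hz, if_neg (by omega)]
  · rw [if_neg h]
    obtain ⟨m, rfl⟩ : ∃ m, n = m + 1 := ⟨n - 1, by omega⟩
    have h2 := (lzj_geom a ha0 ha1 (m + 1)).add
      (hasSum_ite_eq m (a ^ m * (-a / (1 - a))))
    refine lzj_transfer h2 (fun z => ?_) ?_
    · rcases lt_trichotomy z m with hz | rfl | hz
      · rw [lzj_zero a b _ z (by omega), if_neg (by omega : ¬ m + 1 ≤ z), if_neg (by omega : ¬ z = m)]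
        simp
      · rw [if_pos (by omega), lzj_diag, if_neg (by omega), if_neg (by omega), if_pos rfl]
        ring
      · rw [if_pos (by omega), lzj_one a b _ z (by omega), if_pos (by omega), if_neg (by omega)]
        ring
    · field_simp
      ring

lemma lzj_norm (a b : ℝ) (ha0 : 0 < a) (ha1 : a < 1) (hb : b < 1) (x y : ℕ) (h : x < y) :
    (1 - a * b) / (1 - a) * (symCoeff a b x x y * littleZeroJacobiWeight a b x) = 1 := by
  have hab := lzj_ab a b ha0 ha1 hb
  have hb' : (1 - b) ≠ 0 := by linarith
  have h1a : (1 - a) ≠ 0 := by linarith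
  have ha' := ha0.ne'
  rw [lzj_explicit a b ha0 ha1 hb x x y le_rfl h.le, zpow_neg, zpow_natCast]
  rw [if_neg (lt_irrefl x), if_pos h, if_pos h, littleZeroJacobiWeight]
  split_ifs <;> field_simp

lemma lzj_weight (a b : ℝ) (ha0 : 0 < a) (ha1 : a < 1) (hb : b < 1) (x : ℕ) (c p : ℝ) :
    (1 - a * b) / (1 - a) * (c * littleZeroJacobiWeight a b x * p) =
      c * (if x = 0 then 1 else (1 - b) * a ^ x) * p := by
  have hab := lzj_ab a b ha0 ha1 hb
  have h1a : (1 - a) ≠ 0 := by linarith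
  unfold littleZeroJacobiWeight
  split_ifs <;> field_simp

lemma lzj_lt (a b : ℝ) (ha0 : 0 < a) (ha1 : a < 1) (hb : b < 1) (n x y : ℕ) (h : x < y) :
    HasSum
      (fun z : ℕ => (1 - a * b) / (1 - a) *
        (symCoeff a b x y z * littleZeroJacobiWeight a b z * littleZeroJacobi a b n z))
      (littleZeroJacobi a b n x * littleZeroJacobi a b n y) := by
  have hv : littleZeroJacobi a b n x * littleZeroJacobi a b n y = (1 - a * b) / (1 - a) *
        (symCoeff a b x y x * littleZeroJacobiWeight a b x * littleZeroJacobi a b n x) := by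
    have h1 := lzj_norm a b ha0 ha1 hb x y h
    rw [lzj_swap23 a b x y x]
    have h2 : littleZeroJacobi a b n x * littleZeroJacobi a b n y = littleZeroJacobi a b n x := by
      by_cases hn : x + 1 < n
      · rw [lzj_zero a b n x hn, zero_mul]
      · rw [lzj_one a b n y (by omega), mul_one]
    rw [h2]
    linear_combination (-littleZeroJacobi a b n x) * h1
  rw [hv]
  refine hasSum_single x fun z hz => ?_
  have h0 : symCoeff a b x y z = 0 := by
    rcases lt_or_gt_of_ne hz with hz | hz
    · rw [lzj_swap23, lzj_swap12, lzj_explicit a b ha0 ha1 hb z x y hz.le h.le, if_pos hz]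
    · rcases le_total y z with hyz | hyz
      · rw [lzj_explicit a b ha0 ha1 hb x y z h.le hyz, if_pos h]
      · rw [lzj_swap23, lzj_explicit a b ha0 ha1 hb x z y hz.le hyz, if_pos hz]
  rw [h0]
  ring

lemma lzj_eq (a b : ℝ) (ha0 : 0 < a) (ha1 : a < 1) (hb : b < 1) (n x : ℕ) :
    HasSum
      (fun z : ℕ => (1 - a * b) / (1 - a) *
        (symCoeff a b x x z * littleZeroJacobiWeight a b z * littleZeroJacobi a b n z))
      (littleZeroJacobi a b n x * littleZeroJacobi a b n x) := by
  have hab := lzj_ab a b ha0 ha1 hb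
  have hb' : (1 - b) ≠ 0 := by linarith
  have h1a : (1 - a) ≠ 0 := by linarith
  have ha' := ha0.ne'
  have key := ((lzj_tail a b ha0 ha1 n x).mul_left
    ((1 - b) * symCoeff a b x x (x + 1))).add
      (hasSum_ite_eq x ((1 - a * b) / (1 - a) *
        (symCoeff a b x x x * littleZeroJacobiWeight a b x * littleZeroJacobi a b n x)))
  refine lzj_transfer key (fun z => ?_) ?_
  · rcases lt_trichotomy z x with hz | rfl | hz
    · rw [lzj_swap23, lzj_swap12, lzj_explicit a b ha0 ha1 hb z x x hz.le le_rfl, if_pos hz,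
        if_neg (by omega), if_neg (by omega)]
      ring
    · rw [if_neg (lt_irrefl z), if_pos rfl]
      ring
    · have hc : symCoeff a b x x z = symCoeff a b x x (x + 1) := by
        rw [lzj_explicit a b ha0 ha1 hb x x z le_rfl hz.le,
          lzj_explicit a b ha0 ha1 hb x x (x + 1) le_rfl (by omega)]
        simp [hz]
      rw [hc, if_pos hz, if_neg (by omega), littleZeroJacobiWeight, if_neg (by omega)]
      field_simp
      ring
  · rw [lzj_weight a b ha0 ha1 hb, lzj_explicit a b ha0 ha1 hb x x x le_rfl le_rfl,
      lzj_explicit a b ha0 ha1 hb x x (x + 1) le_rfl (by omega), zpow_neg, zpow_natCast]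
    simp only [lt_irrefl, if_false, Nat.lt_succ_self, if_true,
      lt_add_iff_pos_right]
    rcases Nat.lt_or_ge (x + 1) n with hn | hn
    · rw [lzj_zero a b n x hn, if_neg (by omega : ¬ n ≤ x + 1)]
      ring
    · rw [if_pos hn]
      rcases Nat.lt_or_ge x n with hn2 | hn2
      · obtain rfl : n = x + 1 := by omega
        rw [lzj_diag]
        split_ifs with hx
        · subst hx
          field_simp
          ring
        · field_simp
          ring
      · rw [lzj_one a b n x hn2]
        split_ifs with hx
        · subst hx
          field_simp
          ring
        · field_simp
          ring

theorem littleZeroJacobi_symmetric_product_formula (a b : ℝ) (ha0 : 0 < a) (ha1 : a < 1)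
    (hb : b < 1) :
    (∀ x y z : ℕ, symCoeff a b x y z = symCoeff a b y x z) ∧
    (∀ x y z : ℕ, symCoeff a b x y z = symCoeff a b x z y) ∧
    (∀ n x y : ℕ,
      HasSum
        (fun z : ℕ =>
          (1 - a * b) / (1 - a) *
            (symCoeff a b x y z * littleZeroJacobiWeight a b z * littleZeroJacobi a b n z))
        (littleZeroJacobi a b n x * littleZeroJacobi a b n y)) ∧
    (∀ x y z : ℕ, x ≤ y → y ≤ z →
      symCoeff a b x y z =
        if x < y then 0
        else if x = 0 then (if y < z then 1 else (1 - 2 * a + a * b) / (1 - a))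
        else if y < z then (1 - b)⁻¹ * a ^ (-(x : ℤ))
        else (1 - 2 * a) * a ^ (-(x : ℤ)) / ((1 - a) * (1 - b))) := by
  refine ⟨lzj_swap12 a b, lzj_swap23 a b, fun n x y => ?_, lzj_explicit a b ha0 ha1 hb⟩
  rcases lt_trichotomy x y with h | rfl | h
  · exact lzj_lt a b ha0 ha1 hb n x y h
  · exact lzj_eq a b ha0 ha1 hb n x
  · rw [mul_comm (littleZeroJacobi a b n x)]
    simp_rw [lzj_swap12 a b x y]
    exact lzj_lt a b ha0 ha1 hb n y x h
end
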